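/- Let d ∈ ℕ, 1 ≤ s < r < ∞, and β > 0. Set α = s/r and γ = β(r/s − 1). Then there exists a constant C > 0 such that for every mean-zero periodic distribution g on 𝕋^d, ‖g‖_{L^r(𝕋^d)} ≤ C·‖g‖_{Ḃ^{−β}_{∞,∞}(𝕋^d)}^{1−α}·‖g‖_{Ḃ^{γ}_{s,s}(𝕋^d)}^{α}. -/

import Mathlib

open MeasureTheory Set
open scoped ENNReal NNReal

noncomputable section

namespace KSE

/-- `ℝ≥0∞`-valued norm of a real number. -/
def eR (r : ℝ) : ℝ≥0∞ := ENNReal.ofReal |r|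

/-- `ℝ≥0∞`-valued norm of a complex number. -/
def eC (z : ℂ) : ℝ≥0∞ := ENNReal.ofReal ‖z‖

/-- The fundamental domain `[-π, π]^d` of the torus `𝕋^d = ℝ^d/(2πℤ^d)`. -/
def Q (d : ℕ) : Set (Fin d → ℝ) := Set.Icc (fun _ => -Real.pi) (fun _ => Real.pi)

/-- The cube `D = [0,2]^d`. -/
def QD (d : ℕ) : Set (Fin d → ℝ) := Set.Icc (fun _ => 0) (fun _ => 2)

/-- The `2π`-shift of `x` in the `i`-th coordinate. -/
def shift {d : ℕ} (c : ℝ) (i : Fin d) (x : Fin d → ℝ) : Fin d → ℝ :=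
  fun j => if j = i then x j + c else x j

/-- `2π`-periodicity in each coordinate direction: functions on the torus `𝕋^d`. -/
def SpacePeriodic {d : ℕ} {α : Type*} (f : (Fin d → ℝ) → α) : Prop :=
  ∀ (x : Fin d → ℝ) (i : Fin d), f (shift (2 * Real.pi) i x) = f x

/-- `2`-periodicity in each coordinate direction (for the domain `D = [0,2]^d`). -/
def Periodic2 {d : ℕ} {α : Type*} (f : (Fin d → ℝ) → α) : Prop :=
  ∀ (x : Fin d → ℝ) (i : Fin d), f (shift 2 i x) = f x

/-- The Euclidean magnitude `|k|` of a frequency `k ∈ ℤ^d`. -/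
def kmag {d : ℕ} (k : Fin d → ℤ) : ℝ := Real.sqrt (∑ i, ((k i : ℝ)) ^ 2)

/-- Fourier coefficient `f̂(k) = (2π)^{-d} ∫_{[-π,π]^d} f(x) e^{-i k·x} dx`. -/
def fCoeff {d : ℕ} (f : (Fin d → ℝ) → ℝ) (k : Fin d → ℤ) : ℂ :=
  ((2 * Real.pi) ^ d)⁻¹ • ∫ x in Q d,
    (f x : ℂ) * Complex.exp (-Complex.I * ∑ i, (k i : ℂ) * (x i : ℂ))

/-- Squared inhomogeneous Sobolev norm `‖f‖_{H^s}² = Σ_k (1+|k|^{2s}) |f̂(k)|²`. -/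
def HsSq {d : ℕ} (s : ℝ) (f : (Fin d → ℝ) → ℝ) : ℝ≥0∞ :=
  ∑' k : Fin d → ℤ, ENNReal.ofReal (1 + Real.rpow (kmag k) (2 * s)) * eC (fCoeff f k) ^ 2

/-- Squared homogeneous Sobolev norm `‖f‖_{Ḣ^s}² = Σ_k |k|^{2s} |f̂(k)|²`. -/
def HdotSq {d : ℕ} (s : ℝ) (f : (Fin d → ℝ) → ℝ) : ℝ≥0∞ :=
  ∑' k : Fin d → ℤ, ENNReal.ofReal (Real.rpow (kmag k) (2 * s)) * eC (fCoeff f k) ^ 2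

/-- Squared `H^s` norm of a vector field, summing over components. -/
def HsSqV {d : ℕ} (s : ℝ) (u : (Fin d → ℝ) → Fin d → ℝ) : ℝ≥0∞ :=
  ∑ i, HsSq s (fun x => u x i)

/-- Squared `L²(𝕋^d)` norm. -/
def L2Sq {d : ℕ} (f : (Fin d → ℝ) → ℝ) : ℝ≥0∞ := ∫⁻ x in Q d, eR (f x) ^ 2

/-- Partial derivative `∂_i f`. -/
def pd {d : ℕ} (i : Fin d) (f : (Fin d → ℝ) → ℝ) (x : Fin d → ℝ) : ℝ :=
  fderiv ℝ f x (Pi.single i 1)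

/-- Laplacian `Δf = Σ_i ∂_i² f`. -/
def lap {d : ℕ} (f : (Fin d → ℝ) → ℝ) (x : Fin d → ℝ) : ℝ := ∑ i, pd i (pd i f) x

/-- The `i`-th component `u_i(t, ·)` of a time-dependent vector field. -/
def comp {d : ℕ} (u : ℝ → (Fin d → ℝ) → Fin d → ℝ) (t : ℝ) (i : Fin d) :
    (Fin d → ℝ) → ℝ := fun x => u t x i

/-- Time derivative `∂_t u`. -/
def dt {d : ℕ} (u : ℝ → (Fin d → ℝ) → Fin d → ℝ) (t : ℝ) (x : Fin d → ℝ) (i : Fin d) : ℝ :=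
  deriv (fun s => u s x i) t

/-- The nonlinear advection term `((u·∇)u)_i = Σ_j u_j ∂_j u_i`. -/
def advect {d : ℕ} (u : ℝ → (Fin d → ℝ) → Fin d → ℝ) (t : ℝ) (x : Fin d → ℝ) (i : Fin d) : ℝ :=
  ∑ j, u t x j * pd j (comp u t i) x

/-- `u` is a strong solution of the Kuramoto–Sivashinsky equation
`∂_t u + (u·∇)u + λΔu + Δ²u = 0` on `𝕋^d × [0,T)`:
`u ∈ L^∞([0,T); H²) ∩ L²([0,T); H⁴)` and for every smooth periodic test
function `ψ`, `⟨∂_t u, ψ⟩ + ((u·∇)u, ψ) + (Δu, Δψ) = λ(∇u, ∇ψ)`. -/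
structure IsStrongSolution (d : ℕ) (lam T : ℝ) (u : ℝ → (Fin d → ℝ) → Fin d → ℝ) : Prop where
  periodic : ∀ t, SpacePeriodic (u t)
  linftyH2 : (⨆ t ∈ Set.Ico (0 : ℝ) T, HsSqV 2 (u t)) < ⊤
  l2H4 : (∫⁻ t in Set.Ico (0 : ℝ) T, HsSqV 4 (u t)) < ⊤
  weak : ∀ ψ : (Fin d → ℝ) → Fin d → ℝ, ContDiff ℝ (⊤ : ℕ∞) ψ → SpacePeriodic ψ →
    ∀ t ∈ Set.Ico (0 : ℝ) T,
      (∫ x in Q d, ∑ i, (dt u t x i * ψ x i + advect u t x i * ψ x i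
          + lap (comp u t i) x * lap (fun y => ψ y i) x))
        = lam * ∫ x in Q d, ∑ i, ∑ j, pd j (comp u t i) x * pd j (fun y => ψ y i) x

/-- `u` is a classical solution of the Kuramoto–Sivashinsky equation
`∂_t u + (u·∇)u + λΔu + Δ²u = 0` on `𝕋^d × [0,T]`. -/
structure IsClassicalSolution (d : ℕ) (lam T : ℝ) (u : ℝ → (Fin d → ℝ) → Fin d → ℝ) : Prop where
  periodic : ∀ t, SpacePeriodic (u t)
  cont : Continuous (fun p : ℝ × (Fin d → ℝ) => u p.1 p.2)
  tdiff : ∀ t ∈ Set.Icc (0 : ℝ) T, ∀ (x : Fin d → ℝ) (i : Fin d),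
    DifferentiableAt ℝ (fun s => u s x i) t
  xreg : ∀ t ∈ Set.Icc (0 : ℝ) T, ∀ i : Fin d, ContDiff ℝ 4 (comp u t i)
  eqn : ∀ t ∈ Set.Icc (0 : ℝ) T, ∀ (x : Fin d → ℝ) (i : Fin d),
    dt u t x i + advect u t x i + lam * lap (comp u t i) x + lap (lap (comp u t i)) x = 0

/-- Membership `u ∈ H^k(𝕋^d × [0,T])`: all space-time derivatives of total
order at most `k` are square integrable on the cylinder. -/
def HkST (d k : ℕ) (T : ℝ) (u : ℝ → (Fin d → ℝ) → Fin d → ℝ) : Prop :=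
  ∀ (i : Fin d) (n : ℕ), n ≤ k →
    (∫⁻ p : ℝ × (Fin d → ℝ) in (Set.Icc 0 T) ×ˢ Q d,
      ENNReal.ofReal
        ‖iteratedFDeriv ℝ n (fun q : ℝ × (Fin d → ℝ) => u q.1 q.2 i) p‖ ^ 2) < ⊤

/-- Continuity of `t ↦ u(t)` from `[0,T]` into `H^s(𝕋^d)`. -/
def ContInH (d : ℕ) (s T : ℝ) (u : ℝ → (Fin d → ℝ) → Fin d → ℝ) : Prop :=
  ∀ t ∈ Set.Icc (0 : ℝ) T, ∀ ε : ℝ, 0 < ε → ∃ δ > (0 : ℝ), ∀ τ ∈ Set.Icc (0 : ℝ) T,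
    |τ - t| < δ → HsSqV s (fun x i => u τ x i - u t x i) < ENNReal.ofReal ε

/-- `v` is the derivative of `u : [0,T] → H^s(𝕋^d)`, with difference quotients
converging in the `H^s` norm. -/
def HDerivOn (d : ℕ) (s T : ℝ) (u v : ℝ → (Fin d → ℝ) → Fin d → ℝ) : Prop :=
  ∀ t ∈ Set.Icc (0 : ℝ) T, ∀ ε : ℝ, 0 < ε → ∃ δ > (0 : ℝ), ∀ τ ∈ Set.Icc (0 : ℝ) T,
    τ ≠ t → |τ - t| < δ →
      HsSqV s (fun x i => (τ - t)⁻¹ * (u τ x i - u t x i) - v t x i) < ENNReal.ofReal ε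

/-- `u ∈ ⋂_{ℓ=0}^k C^ℓ([0,T]; H^{m-4ℓ}(𝕋^d))`: there is a sequence of time
derivatives `v ℓ` of `u`, the `ℓ`-th one being continuous into `H^{m-4ℓ}`. -/
def CkIntoH (d k : ℕ) (m T : ℝ) (u : ℝ → (Fin d → ℝ) → Fin d → ℝ) : Prop :=
  ∃ v : ℕ → ℝ → (Fin d → ℝ) → Fin d → ℝ, v 0 = u ∧
    (∀ j < k, HDerivOn d (m - 4 * ((j : ℝ) + 1)) T (v j) (v (j + 1))) ∧
    (∀ j ≤ k, ContInH d (m - 4 * (j : ℝ)) T (v j))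

/-- A Littlewood–Paley function `φ`: smooth, `0 ≤ φ ≤ 1`, supported in the
annulus `{1/2 < |ξ| < 2}`, with `Σ_{j∈ℤ} φ(2^{-j}ξ) = 1` for `ξ ≠ 0`. -/
def IsLP (d : ℕ) (φ : (Fin d → ℝ) → ℝ) : Prop :=
  ContDiff ℝ (⊤ : ℕ∞) φ ∧ (∀ ξ, 0 ≤ φ ξ ∧ φ ξ ≤ 1) ∧
  (∀ ξ : Fin d → ℝ, φ ξ ≠ 0 →
    1 / 2 < Real.sqrt (∑ i, ξ i ^ 2) ∧ Real.sqrt (∑ i, ξ i ^ 2) < 2) ∧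
  (∀ ξ : Fin d → ℝ, ξ ≠ 0 → ∑' j : ℤ, φ (fun i => (2 : ℝ) ^ (-j) * ξ i) = 1)

/-- The Littlewood–Paley block `(φ_j * f)(x) = (2π)^d Σ_k φ(2^{-j}k) f̂(k) e^{i k·x}`. -/
def lpBlock {d : ℕ} (φ : (Fin d → ℝ) → ℝ) (j : ℤ) (f : (Fin d → ℝ) → ℝ)
    (x : Fin d → ℝ) : ℂ :=
  (2 * Real.pi) ^ d * ∑' k : Fin d → ℤ,
    (φ (fun i => (2 : ℝ) ^ (-j) * (k i : ℝ)) : ℂ) * fCoeff f k *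
      Complex.exp (Complex.I * ∑ i, (k i : ℂ) * (x i : ℂ))

/-- Homogeneous Besov norm `‖f‖_{Ḃ^s_{∞,∞}} = sup_j 2^{sj} ‖φ_j * f‖_{L^∞(𝕋^d)}`. -/
def besovInfInf {d : ℕ} (φ : (Fin d → ℝ) → ℝ) (s : ℝ) (f : (Fin d → ℝ) → ℝ) : ℝ≥0∞ :=
  ⨆ j : ℤ, ENNReal.ofReal (Real.rpow 2 (s * j)) * ⨆ x ∈ Q d, eC (lpBlock φ j f x)

/-- Homogeneous Besov norm `‖f‖_{Ḃ^s_{p,p}} = (Σ_j (2^{sj} ‖φ_j * f‖_{L^p(𝕋^d)})^p)^{1/p}`. -/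
def besovPP {d : ℕ} (φ : (Fin d → ℝ) → ℝ) (s p : ℝ) (f : (Fin d → ℝ) → ℝ) : ℝ≥0∞ :=
  (∑' j : ℤ, (ENNReal.ofReal (Real.rpow 2 (s * j)) *
      (∫⁻ x in Q d, eC (lpBlock φ j f x) ^ p) ^ (1 / p)) ^ p) ^ (1 / p)

/-- Vector-field Besov norm `Ḃ^s_{∞,∞}`, summing over components. -/
def besovInfInfV {d : ℕ} (φ : (Fin d → ℝ) → ℝ) (s : ℝ)
    (u : (Fin d → ℝ) → Fin d → ℝ) : ℝ≥0∞ :=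
  ∑ i, besovInfInf φ s (fun x => u x i)

end KSE

open KSE

namespace KSE

open Topology

lemma isCompact_Q (d : ℕ) : IsCompact (Q d) := isCompact_Icc

lemma measurableSet_Q (d : ℕ) : MeasurableSet (Q d) := measurableSet_Icc

lemma mem_Q {d : ℕ} {x : Fin d → ℝ} : x ∈ Q d ↔ ∀ i, -Real.pi ≤ x i ∧ x i ≤ Real.pi := by
  simp only [Q, Set.mem_Icc, Pi.le_def, forall_and]

lemma Q_eq_pi (d : ℕ) : Q d = Set.univ.pi fun _ => Set.Icc (-Real.pi) Real.pi :=
  (Set.pi_univ_Icc _ _).symm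

/-- The interior of the fundamental domain. -/
def openQ (d : ℕ) : Set (Fin d → ℝ) := Set.univ.pi fun _ => Set.Ioo (-Real.pi) Real.pi

lemma isOpen_openQ (d : ℕ) : IsOpen (openQ d) :=
  isOpen_set_pi Set.finite_univ fun _ _ => isOpen_Ioo

lemma openQ_subset_Q (d : ℕ) : openQ d ⊆ Q d := by
  rw [Q_eq_pi]
  exact Set.pi_mono fun _ _ => Set.Ioo_subset_Icc_self

lemma openQ_ae_eq_Q (d : ℕ) : openQ d =ᵐ[volume] Q d :=
  Measure.univ_pi_Ioo_ae_eq_Icc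

/-- The character `x ↦ e^{i k·x}`. -/
def character {d : ℕ} (k : Fin d → ℤ) (x : Fin d → ℝ) : ℂ :=
  Complex.exp (Complex.I * ∑ i, (k i : ℂ) * (x i : ℂ))

lemma continuous_character {d : ℕ} (k : Fin d → ℤ) : Continuous (character k) := by
  unfold character; fun_prop

lemma norm_character {d : ℕ} (k : Fin d → ℤ) (x : Fin d → ℝ) : ‖character k x‖ = 1 := by
  have : Complex.I * ∑ i, (k i : ℂ) * (x i : ℂ) =
      ((∑ i, (k i : ℝ) * x i : ℝ) : ℂ) * Complex.I := by
    push_cast; ring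
  rw [character, this, Complex.norm_exp_ofReal_mul_I]

lemma character_neg {d : ℕ} (k : Fin d → ℤ) (x : Fin d → ℝ) :
    character (-k) x = Complex.exp (-Complex.I * ∑ i, (k i : ℂ) * (x i : ℂ)) := by
  simp [character]

lemma character_mul {d : ℕ} (k l : Fin d → ℤ) (x : Fin d → ℝ) :
    character k x * character l x = character (k + l) x := by
  simp only [character, ← Complex.exp_add, ← mul_add, ← Finset.sum_add_distrib, Pi.add_apply,
    Int.cast_add, add_mul]

lemma character_eq_prod {d : ℕ} (k : Fin d → ℤ) (x : Fin d → ℝ) :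
    character k x = ∏ i, Complex.exp (Complex.I * k i * x i) := by
  simp only [character, Finset.mul_sum, Complex.exp_sum, mul_assoc]

/-- The projection of `ℝ^d` onto the unit torus, rescaled to have period `2π`. -/
def torusProj {d : ℕ} (x : Fin d → ℝ) : UnitAddTorus (Fin d) :=
  fun i => ((x i / (2 * Real.pi) : ℝ) : UnitAddCircle)

lemma continuous_torusProj {d : ℕ} : Continuous (torusProj (d := d)) :=
  continuous_pi fun i =>
    (AddCircle.continuous_mk' (1 : ℝ)).comp ((continuous_apply i).div_const _)

lemma mFourier_torusProj {d : ℕ} (k : Fin d → ℤ) (x : Fin d → ℝ) :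
    UnitAddTorus.mFourier k (torusProj x) = character k x := by
  rw [character_eq_prod]
  change ∏ i, fourier (k i) (torusProj x i) = _
  refine Finset.prod_congr rfl fun i _ => ?_
  simp only [torusProj, fourier_coe_apply]
  congr 1
  have : (Real.pi : ℂ) ≠ 0 := by exact_mod_cast Real.pi_ne_zero
  push_cast
  field_simp

lemma torusProj_surjOn_Q {d : ℕ} (θ : UnitAddTorus (Fin d)) : ∃ x ∈ Q d, torusProj x = θ := by
  have h : ∀ i, ∃ t ∈ Set.Ico (-(1 / 2) : ℝ) (-(1 / 2) + 1), (t : UnitAddCircle) = θ i := by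
    intro i
    have := AddCircle.coe_image_Ico_eq (1 : ℝ) (-(1 / 2))
    have h2 : θ i ∈ (Set.univ : Set UnitAddCircle) := Set.mem_univ _
    rw [← this] at h2
    exact h2
  choose t ht hθ using h
  have hpi := Real.pi_pos
  refine ⟨fun i => t i * (2 * Real.pi), mem_Q.2 fun i => ?_, ?_⟩
  · have := ht i
    constructor <;> nlinarith [this.1, this.2]
  · funext i
    rw [← hθ i, torusProj]
    congr 1
    field_simp

lemma eq_of_torusProj_eq {d : ℕ} {x y : Fin d → ℝ} (hx : x ∈ openQ d) (hy : y ∈ Q d)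
    (h : torusProj x = torusProj y) : x = y := by
  funext i
  have hi : ((x i / (2 * Real.pi) : ℝ) : UnitAddCircle) = ((y i / (2 * Real.pi) : ℝ)) :=
    congrFun h i
  rw [← sub_eq_zero, ← AddCircle.coe_sub, AddCircle.coe_eq_zero_iff] at hi
  obtain ⟨n, hn⟩ := hi
  have hpi := Real.pi_pos
  have hx' := hx i (Set.mem_univ i)
  have hy' := mem_Q.1 hy i
  have hn' : (n : ℝ) * (2 * Real.pi) = x i - y i := by
    have : (n : ℝ) = x i / (2 * Real.pi) - y i / (2 * Real.pi) := by simpa using hn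
    rw [this]; field_simp
  have h1 : (n : ℝ) < 1 := by nlinarith [hx'.1, hx'.2, hy'.1, hy'.2]
  have h2 : (-1 : ℝ) < n := by nlinarith [hx'.1, hx'.2, hy'.1, hy'.2]
  have h3 : n = 0 := by
    have h1' : n < 1 := by exact_mod_cast h1
    have h2' : -1 < n := by exact_mod_cast h2
    omega
  rw [h3] at hn'
  simp at hn'
  linarith

/-- A continuous function vanishing outside the open cube descends to the torus. -/
lemma exists_continuousMap_torusProj {d : ℕ} {u : (Fin d → ℝ) → ℂ} (hu : Continuous u)
    (hsupp : ∀ x ∉ openQ d, u x = 0) :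
    ∃ v : C(UnitAddTorus (Fin d), ℂ), ∀ x ∈ Q d, v (torusProj x) = u x := by
  have : CompactSpace (Q d) := isCompact_iff_compactSpace.1 (isCompact_Q d)
  let p : C(Q d, UnitAddTorus (Fin d)) :=
    ⟨fun x => torusProj x.1, continuous_torusProj.comp continuous_subtype_val⟩
  have hp : IsQuotientMap p := by
    refine p.continuous.isClosedMap.isQuotientMap p.continuous fun θ => ?_
    obtain ⟨x, hx, h⟩ := torusProj_surjOn_Q θ
    exact ⟨⟨x, hx⟩, h⟩
  let w : C(Q d, ℂ) := ⟨fun x => u x.1, hu.comp continuous_subtype_val⟩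
  have hw : Function.FactorsThrough w p := by
    rintro ⟨x, hx⟩ ⟨y, hy⟩ hxy
    change u x = u y
    by_cases hxo : x ∈ openQ d
    · rw [eq_of_torusProj_eq hxo hy hxy]
    by_cases hyo : y ∈ openQ d
    · rw [eq_of_torusProj_eq hyo hx hxy.symm]
    rw [hsupp x hxo, hsupp y hyo]
  refine ⟨hp.lift w hw, fun x hx => ?_⟩
  exact DFunLike.congr_fun (hp.lift_comp w hw) ⟨x, hx⟩

lemma integral_mul_torusProj_eq_zero {d : ℕ} {f : (Fin d → ℝ) → ℂ} (hf : IntegrableOn f (Q d))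
    (h : ∀ k : Fin d → ℤ, ∫ x in Q d, f x * character k x = 0)
    (v : C(UnitAddTorus (Fin d), ℂ)) : ∫ x in Q d, f x * v (torusProj x) = 0 := by
  have hint : ∀ v : C(UnitAddTorus (Fin d), ℂ),
      Integrable (fun x => f x * v (torusProj x)) (volume.restrict (Q d)) := fun v =>
    hf.mul_bdd (v.continuous.comp continuous_torusProj).aestronglyMeasurable
      (Filter.Eventually.of_forall fun x => v.norm_coe_le_norm _)
  let L : C(UnitAddTorus (Fin d), ℂ) →ₗ[ℂ] ℂ :=
    { toFun := fun v => ∫ x in Q d, f x * v (torusProj x)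
      map_add' := fun v w => by
        simp only [ContinuousMap.add_apply, mul_add]
        exact integral_add (hint v) (hint w)
      map_smul' := fun c v => by
        simp only [ContinuousMap.smul_apply, smul_eq_mul, RingHom.id_apply]
        rw [← integral_const_mul]
        congr 1; funext x; ring }
  let L' := L.mkContinuous (∫ x in Q d, ‖f x‖) fun v => by
    change ‖∫ x in Q d, f x * v (torusProj x)‖ ≤ _
    rw [← integral_mul_const]
    refine norm_integral_le_of_norm_le (hf.norm.mul_const _) (Filter.Eventually.of_forall ?_)
    intro x
    rw [norm_mul]
    gcongr
    exact v.norm_coe_le_norm _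
  have hL' : L' = 0 := by
    refine ContinuousLinearMap.ext_on (s := Set.range UnitAddTorus.mFourier) ?_ ?_
    · rw [dense_iff_closure_eq, ← Submodule.topologicalClosure_coe,
        UnitAddTorus.span_mFourier_closure_eq_top]
      rfl
    · rintro _ ⟨k, rfl⟩
      change ∫ x in Q d, f x * UnitAddTorus.mFourier k (torusProj x) = 0
      simp only [mFourier_torusProj, h]
  exact DFunLike.congr_fun hL' v

/-- An integrable function on the cube all of whose Fourier coefficients vanish is zero a.e. -/
lemma ae_eq_zero_of_integral_character {d : ℕ} {f : (Fin d → ℝ) → ℂ}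
    (hf : IntegrableOn f (Q d))
    (h : ∀ k : Fin d → ℤ, ∫ x in Q d, f x * character k x = 0) :
    ∀ᵐ x ∂volume.restrict (Q d), f x = 0 := by
  rw [← Measure.restrict_congr_set (openQ_ae_eq_Q d),
    ae_restrict_iff' (isOpen_openQ d).measurableSet]
  refine (isOpen_openQ d).ae_eq_zero_of_integral_contDiff_smul_eq_zero
    (hf.mono_set (openQ_subset_Q d)).locallyIntegrableOn fun u hu _ hsupp => ?_
  have hzero : ∀ x ∉ openQ d, u x = 0 := fun x hx =>
    image_eq_zero_of_notMem_tsupport fun hx' => hx (hsupp hx')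
  obtain ⟨v, hv⟩ := exists_continuousMap_torusProj (d := d) (u := fun x => (u x : ℂ))
    (Complex.continuous_ofReal.comp hu.continuous) (fun x hx => by simp [hzero x hx])
  rw [← integral_mul_torusProj_eq_zero hf h v, ← setIntegral_eq_integral_of_forall_compl_eq_zero
    (s := Q d) (fun x hx => by simp [hzero x fun hx' => hx (openQ_subset_Q d hx')])]
  refine setIntegral_congr_fun (measurableSet_Q d) fun x hx => ?_
  simp only [hv x hx, Complex.real_smul, mul_comm]

lemma integral_character {d : ℕ} (k : Fin d → ℤ) :
    ∫ x in Q d, character k x = if k = 0 then ((2 * Real.pi) ^ d : ℂ) else 0 := by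
  have hone : ∀ n : ℤ, ∫ t in Set.Icc (-Real.pi) Real.pi, Complex.exp (Complex.I * n * t) =
      if n = 0 then (2 * Real.pi : ℂ) else 0 := by
    intro n
    rw [integral_Icc_eq_integral_Ioc,
      ← intervalIntegral.integral_of_le (by linarith [Real.pi_pos])]
    split_ifs with hn
    · simp [hn]; ring
    · have hc : Complex.I * (n : ℂ) ≠ 0 := mul_ne_zero Complex.I_ne_zero (by exact_mod_cast hn)
      rw [integral_exp_mul_complex hc, div_eq_zero_iff, sub_eq_zero]
      left
      rw [Complex.exp_eq_exp_iff_exists_int]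
      exact ⟨n, by push_cast; ring⟩
  simp only [character_eq_prod]
  rw [Q_eq_pi, volume_pi, Measure.restrict_pi_pi,
    integral_fintype_prod_eq_prod (fun i (t : ℝ) => Complex.exp (Complex.I * k i * t))]
  simp only [hone]
  split_ifs with hk
  · simp [hk]
  · obtain ⟨i, hi⟩ := Function.ne_iff.1 hk
    exact Finset.prod_eq_zero (Finset.mem_univ i) (if_neg hi)

lemma integral_mul_character_neg {d : ℕ} (f : (Fin d → ℝ) → ℝ) (k : Fin d → ℤ) :
    ∫ x in Q d, (f x : ℂ) * character (-k) x = (2 * Real.pi) ^ d * fCoeff f k := by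
  have h : ((2 * Real.pi) ^ d : ℝ) ≠ 0 := (pow_pos Real.two_pi_pos d).ne'
  have h' : ((2 * Real.pi) ^ d : ℂ) ≠ 0 := by exact_mod_cast h
  simp only [fCoeff, character_neg, Complex.real_smul]
  push_cast
  rw [← mul_assoc, mul_inv_cancel₀ h', one_mul]

lemma finite_support_dilation {d : ℕ} {φ : (Fin d → ℝ) → ℝ} (hφ : IsLP d φ) (j : ℤ) :
    {k : Fin d → ℤ | φ (fun i => (2 : ℝ) ^ (-j) * (k i : ℝ)) ≠ 0}.Finite := by
  obtain ⟨N, hN⟩ := exists_nat_ge (2 * (2 : ℝ) ^ j)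
  refine (Set.finite_Icc (fun _ => -(N : ℤ)) (fun _ => (N : ℤ))).subset fun k hk => ?_
  have hlt := (hφ.2.2.1 _ hk).2
  have hbound : ∀ i, |(k i : ℝ)| ≤ N := by
    intro i
    have h1 : |(2 : ℝ) ^ (-j) * (k i : ℝ)| < 2 := by
      refine lt_of_le_of_lt ?_ hlt
      rw [← Real.sqrt_sq_eq_abs]
      exact Real.sqrt_le_sqrt (Finset.single_le_sum
        (f := fun i => ((2 : ℝ) ^ (-j) * (k i : ℝ)) ^ 2) (fun _ _ => sq_nonneg _)
        (Finset.mem_univ i))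
    have hpos : (0 : ℝ) < 2 ^ j := by positivity
    rw [abs_mul, abs_of_pos (by positivity), zpow_neg, inv_mul_lt_iff₀ hpos] at h1
    linarith
  constructor <;> intro i
  · have := (abs_le.1 (hbound i)).1
    exact_mod_cast this
  · have := (abs_le.1 (hbound i)).2
    exact_mod_cast this

lemma lpBlock_eq_sum {d : ℕ} {φ : (Fin d → ℝ) → ℝ} (hφ : IsLP d φ) (j : ℤ)
    (f : (Fin d → ℝ) → ℝ) (x : Fin d → ℝ) :
    lpBlock φ j f x = ∑ k ∈ (finite_support_dilation hφ j).toFinset, (2 * Real.pi) ^ d *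
      ((φ (fun i => (2 : ℝ) ^ (-j) * (k i : ℝ)) : ℂ) * fCoeff f k) * character k x := by
  rw [lpBlock, tsum_eq_sum (s := (finite_support_dilation hφ j).toFinset), Finset.mul_sum]
  · exact Finset.sum_congr rfl fun k _ => by rw [character]; ring
  · intro k hk
    have : φ (fun i => (2 : ℝ) ^ (-j) * (k i : ℝ)) = 0 := by simpa using hk
    rw [this]; simp

lemma continuous_lpBlock {d : ℕ} {φ : (Fin d → ℝ) → ℝ} (hφ : IsLP d φ) (j : ℤ)
    (f : (Fin d → ℝ) → ℝ) : Continuous (lpBlock φ j f) := by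
  rw [funext (lpBlock_eq_sum hφ j f)]
  exact continuous_finsetSum _ fun k _ => continuous_const.mul (continuous_character k)

lemma measurable_eC_lpBlock {d : ℕ} {φ : (Fin d → ℝ) → ℝ} (hφ : IsLP d φ) (j : ℤ)
    (f : (Fin d → ℝ) → ℝ) : Measurable fun x => eC (lpBlock φ j f x) :=
  ENNReal.measurable_ofReal.comp (continuous_lpBlock hφ j f).norm.measurable

lemma integral_lpBlock_mul_character_neg {d : ℕ} {φ : (Fin d → ℝ) → ℝ} (hφ : IsLP d φ) (j : ℤ)
    (f : (Fin d → ℝ) → ℝ) (l : Fin d → ℤ) :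
    ∫ x in Q d, lpBlock φ j f x * character (-l) x =
      (φ (fun i => (2 : ℝ) ^ (-j) * (l i : ℝ)) : ℂ) *
        ((2 * Real.pi) ^ d * ((2 * Real.pi) ^ d * fCoeff f l)) := by
  simp only [lpBlock_eq_sum hφ, Finset.sum_mul, mul_assoc, character_mul]
  rw [integral_finsetSum _ fun k _ => ((((continuous_character _).const_mul _).const_mul _).const_mul
    _).continuousOn.integrableOn_compact (isCompact_Q d)]
  simp only [integral_const_mul, integral_character]
  rw [Finset.sum_eq_single l]
  · simp; ring
  · intro k _ hk
    rw [if_neg]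
    · simp
    · intro h
      exact hk (by rwa [← sub_eq_add_neg, sub_eq_zero] at h)
  · intro hl
    have : φ (fun i => (2 : ℝ) ^ (-j) * (l i : ℝ)) = 0 := by simpa using hl
    rw [this]; simp

lemma hasSum_dilation {d : ℕ} {φ : (Fin d → ℝ) → ℝ} (hφ : IsLP d φ) {ξ : Fin d → ℝ} (hξ : ξ ≠ 0) :
    HasSum (fun j : ℤ => φ (fun i => (2 : ℝ) ^ (-j) * ξ i)) 1 := by
  have h := hφ.2.2.2 ξ hξ
  rw [← h]
  refine Summable.hasSum (by_contra fun hns => ?_)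
  rw [tsum_eq_zero_of_not_summable hns] at h
  exact zero_ne_one h

lemma eC_eq_enorm (z : ℂ) : eC z = ‖z‖ₑ := ofReal_norm z

lemma fCoeff_zero {d : ℕ} {g : (Fin d → ℝ) → ℝ} (hmean : ∫ x in Q d, g x = 0) :
    fCoeff g 0 = 0 := by
  have : ∫ x in Q d, (g x : ℂ) = 0 := by rw [integral_complex_ofReal, hmean, Complex.ofReal_zero]
  simp [fCoeff, this]

/-- A mean-zero integrable function is dominated a.e. by the absolute sum of its
Littlewood–Paley blocks, provided that sum is integrable. -/
lemma ae_eR_le_tsum_lpBlock {d : ℕ} {φ : (Fin d → ℝ) → ℝ} (hφ : IsLP d φ)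
    {g : (Fin d → ℝ) → ℝ} (hg : IntegrableOn g (Q d)) (hmean : ∫ x in Q d, g x = 0)
    (hG : ∫⁻ x in Q d, ∑' j : ℤ, eC (lpBlock φ j g x) ≠ ⊤) :
    ∀ᵐ x ∂volume.restrict (Q d), eR (g x) ≤ ∑' j : ℤ, eC (lpBlock φ j g x) := by
  have hmeas : ∀ j : ℤ, AEStronglyMeasurable (lpBlock φ j g) (volume.restrict (Q d)) :=
    fun j => (continuous_lpBlock hφ j g).aestronglyMeasurable
  have hgC : IntegrableOn (fun x => (g x : ℂ)) (Q d) := hg.ofReal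
  have hsum_int : IntegrableOn (fun x => ∑' j : ℤ, lpBlock φ j g x) (Q d) := by
    refine ⟨AEStronglyMeasurable.tsum hmeas, ?_⟩
    refine lt_of_le_of_lt (lintegral_mono fun x => ?_) hG.lt_top
    simp only [eC_eq_enorm]
    exact enorm_tsum_le_tsum_enorm
  have hlint : ∑' j : ℤ, ∫⁻ x in Q d, ‖lpBlock φ j g x‖ₑ ≠ ⊤ := by
    rw [← lintegral_tsum fun j => (hmeas j).enorm]
    simpa only [eC_eq_enorm] using hG
  have hcoef : ∀ k : Fin d → ℤ,
      ∫ x in Q d, (∑' j : ℤ, lpBlock φ j g x) * character (-k) x =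
        (2 * Real.pi) ^ d * ((2 * Real.pi) ^ d * fCoeff g k) := by
    intro k
    simp only [← tsum_mul_right]
    rw [integral_tsum]
    · simp only [integral_lpBlock_mul_character_neg hφ, tsum_mul_right]
      by_cases hk : k = 0
      · simp [hk, fCoeff_zero hmean]
      · have hk' : (fun i => (k i : ℝ)) ≠ 0 := fun h => hk <| funext fun i => by
          have := congrFun h i
          simpa using this
        have := (hasSum_dilation hφ hk').mapL Complex.ofRealCLM
        have h2 := this.tsum_eq
        simp only [Complex.ofRealCLM_apply, Complex.ofReal_one] at h2
        rw [h2, one_mul]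
    · exact fun j => (hmeas j).mul (continuous_character _).aestronglyMeasurable
    · have : ∀ k (x : Fin d → ℝ), ‖character k x‖ₑ = 1 := fun k x => by
        rw [← ofReal_norm, norm_character, ENNReal.ofReal_one]
      simpa only [enorm_mul, this, mul_one] using hlint
  have hzero := ae_eq_zero_of_integral_character
    (f := fun x => (∑' j : ℤ, lpBlock φ j g x) - (2 * Real.pi) ^ d * (g x : ℂ))
    (hsum_int.sub (hgC.const_mul _)) fun k => by
      have hb : ∀ f : (Fin d → ℝ) → ℂ, IntegrableOn f (Q d) →
          Integrable (fun x => f x * character k x) (volume.restrict (Q d)) := fun f hf =>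
        hf.mul_bdd (continuous_character k).aestronglyMeasurable
          (Filter.Eventually.of_forall fun x => (norm_character k x).le)
      simp only [sub_mul]
      rw [integral_sub (hb _ hsum_int) (hb _ (hgC.const_mul _))]
      simp only [mul_assoc, integral_const_mul]
      have h1 := hcoef (-k)
      have h2 := integral_mul_character_neg g (-k)
      rw [neg_neg] at h1 h2
      rw [h1, h2, sub_self]
  filter_upwards [hzero] with x hx
  have hone : (1 : ℝ) ≤ (2 * Real.pi) ^ d :=
    one_le_pow₀ (by linarith [Real.pi_gt_three])
  have hle : |g x| ≤ ‖∑' j : ℤ, lpBlock φ j g x‖ := by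
    rw [sub_eq_zero.1 hx]
    have : ((2 * Real.pi) ^ d * (g x : ℂ)) = (((2 * Real.pi) ^ d * g x : ℝ) : ℂ) := by
      push_cast; rfl
    rw [this, Complex.norm_real, Real.norm_eq_abs, abs_mul,
      abs_of_pos (zero_lt_one.trans_le hone)]
    nlinarith [abs_nonneg (g x)]
  calc eR (g x) ≤ eC (∑' j : ℤ, lpBlock φ j g x) := ENNReal.ofReal_le_ofReal hle
    _ ≤ _ := by
      simp only [eC_eq_enorm]
      exact enorm_tsum_le_tsum_enorm

lemma summable_pow_natAbs {q : ℝ} (h0 : 0 ≤ q) (h1 : q < 1) :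
    Summable fun m : ℤ => q ^ m.natAbs := by
  refine Summable.of_nat_of_neg ?_ ?_ <;>
  simpa using summable_geometric_of_lt_one h0 h1

lemma two_rpow_min_bound {β γ : ℝ} (hβ : 0 < β) (hγ : 0 < γ) (a b : ℝ) :
    ∃ n : ℤ, ∀ j : ℤ, ∀ y : ℝ, y ≤ (2 : ℝ) ^ (a + β * j) → y ≤ (2 : ℝ) ^ (b - γ * j) →
      y ≤ (2 : ℝ) ^ ((γ * a + β * b) / (β + γ)) *
        ((2 : ℝ) ^ γ * ((2 : ℝ) ^ (-min β γ)) ^ (j - n).natAbs) := by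
  have hs : 0 < β + γ := add_pos hβ hγ
  set t := (b - a) / (β + γ) with ht
  have hμ1 : (γ * a + β * b) / (β + γ) = a + β * t := by rw [ht]; field_simp; ring
  have hμ2 : (γ * a + β * b) / (β + γ) = b - γ * t := by rw [ht]; field_simp; ring
  refine ⟨⌊t⌋, fun j y h1 h2 => ?_⟩
  have hfl := Int.floor_le t
  have hfl' := Int.lt_floor_add_one t
  rw [← Real.rpow_natCast, ← Real.rpow_mul zero_le_two, ← Real.rpow_add zero_lt_two,
    ← Real.rpow_add zero_lt_two]
  have habs : (((j - ⌊t⌋).natAbs : ℕ) : ℝ) = |(j : ℝ) - ⌊t⌋| := by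
    rw [Nat.cast_natAbs]; push_cast; rfl
  rw [habs]
  rcases le_total (j : ℝ) ⌊t⌋ with hj | hj
  · refine h1.trans (Real.rpow_le_rpow_of_exponent_le one_le_two ?_)
    rw [hμ1, abs_of_nonpos (by linarith)]
    nlinarith [min_le_left β γ]
  · refine h2.trans (Real.rpow_le_rpow_of_exponent_le one_le_two ?_)
    rw [hμ2, abs_of_nonneg (by linarith)]
    nlinarith [min_le_right β γ]

/-- A sequence growing at most like `2^{βj}` and decaying at least like `2^{-γj}` has its sum
bounded by the corresponding interpolation of the two constants. -/
lemma exists_tsum_le_interpolation {β γ : ℝ} (hβ : 0 < β) (hγ : 0 < γ) :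
    ∃ C : ℝ, 0 < C ∧ ∀ (a : ℤ → ℝ≥0∞) (A B : ℝ≥0∞), A ≠ ⊤ → B ≠ ⊤ →
      (∀ j : ℤ, ENNReal.ofReal ((2 : ℝ) ^ (-β * j)) * a j ≤ A) →
      (∀ j : ℤ, ENNReal.ofReal ((2 : ℝ) ^ (γ * j)) * a j ≤ B) →
      ∑' j, a j ≤ ENNReal.ofReal C * (A ^ (γ / (β + γ)) * B ^ (β / (β + γ))) := by
  have hs : 0 < β + γ := add_pos hβ hγ
  set q : ℝ := (2 : ℝ) ^ (-min β γ) with hq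
  have hq0 : 0 ≤ q := by positivity
  have hq1 : q < 1 := Real.rpow_lt_one_of_one_lt_of_neg one_lt_two (neg_neg_of_pos (lt_min hβ hγ))
  have hsum := summable_pow_natAbs hq0 hq1
  have hpos : 0 < ∑' m : ℤ, q ^ m.natAbs :=
    hsum.tsum_pos (fun m => by positivity) 0 (by simp)
  refine ⟨(2 : ℝ) ^ γ * ∑' m : ℤ, q ^ m.natAbs, by positivity, fun a A B hA hB h1 h2 => ?_⟩
  have hw : ∀ x : ℝ, ENNReal.ofReal ((2 : ℝ) ^ x) ≠ 0 := fun x => by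
    simpa using Real.rpow_pos_of_pos zero_lt_two x
  have hzero : A = 0 ∨ B = 0 → ∑' j, a j = 0 := by
    rintro (rfl | rfl) <;> refine ENNReal.tsum_eq_zero.2 fun j => ?_
    · exact (mul_eq_zero.1 (nonpos_iff_eq_zero.1 (h1 j))).resolve_left (hw _)
    · exact (mul_eq_zero.1 (nonpos_iff_eq_zero.1 (h2 j))).resolve_left (hw _)
  by_cases hA0 : A = 0
  · rw [hzero (.inl hA0)]; exact zero_le
  by_cases hB0 : B = 0
  · rw [hzero (.inr hB0)]; exact zero_le
  have hAp : 0 < A.toReal := ENNReal.toReal_pos hA0 hA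
  have hBp : 0 < B.toReal := ENNReal.toReal_pos hB0 hB
  have key : ∀ (x : ℝ) (y D : ℝ≥0∞), D ≠ 0 → D ≠ ⊤ → ENNReal.ofReal ((2 : ℝ) ^ x) * y ≤ D →
      y ≠ ⊤ ∧ y.toReal ≤ (2 : ℝ) ^ (Real.logb 2 D.toReal - x) := by
    intro x y D hD0 hD h
    have hy : y ≠ ⊤ := by
      rintro rfl
      rw [ENNReal.mul_top (hw x)] at h
      exact hD (top_le_iff.1 h)
    refine ⟨hy, ?_⟩
    have h' := ENNReal.toReal_mono hD h
    have h2x : (0 : ℝ) < 2 ^ x := by positivity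
    rw [ENNReal.toReal_mul, ENNReal.toReal_ofReal h2x.le] at h'
    rw [Real.rpow_sub zero_lt_two, Real.rpow_logb zero_lt_two (by norm_num)
      (ENNReal.toReal_pos hD0 hD), le_div_iff₀ h2x]
    linarith
  obtain ⟨n, hn⟩ := two_rpow_min_bound hβ hγ (Real.logb 2 A.toReal) (Real.logb 2 B.toReal)
  set M : ℝ := (2 : ℝ) ^ ((γ * Real.logb 2 A.toReal + β * Real.logb 2 B.toReal) / (β + γ)) with hM
  have hMpos : 0 < M := by positivity
  have hMAB : ENNReal.ofReal M = A ^ (γ / (β + γ)) * B ^ (β / (β + γ)) := by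
    conv_rhs => rw [← ENNReal.ofReal_toReal hA, ← ENNReal.ofReal_toReal hB]
    rw [ENNReal.ofReal_rpow_of_pos hAp, ENNReal.ofReal_rpow_of_pos hBp,
      ← ENNReal.ofReal_mul (by positivity)]
    congr 1
    conv_rhs => rw [← Real.rpow_logb zero_lt_two (by norm_num) hAp,
      ← Real.rpow_logb zero_lt_two (by norm_num) hBp]
    rw [← Real.rpow_mul zero_le_two, ← Real.rpow_mul zero_le_two, ← Real.rpow_add zero_lt_two, hM]
    congr 1
    ring
  have hterm : ∀ j, a j ≤ ENNReal.ofReal (M * 2 ^ γ) * ENNReal.ofReal (q ^ (j - n).natAbs) := by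
    intro j
    obtain ⟨hfin, hu⟩ := key _ _ _ hA0 hA (h1 j)
    obtain ⟨-, hv⟩ := key _ _ _ hB0 hB (h2 j)
    rw [← ENNReal.ofReal_mul (by positivity), ← ENNReal.ofReal_toReal hfin, mul_assoc]
    refine ENNReal.ofReal_le_ofReal (hn j _ (hu.trans_eq ?_) hv)
    congr 1
    ring
  calc ∑' j, a j
      ≤ ∑' j : ℤ, ENNReal.ofReal (M * 2 ^ γ) * ENNReal.ofReal (q ^ (j - n).natAbs) :=
        ENNReal.tsum_le_tsum hterm
    _ = ENNReal.ofReal (M * 2 ^ γ) * ∑' m : ℤ, ENNReal.ofReal (q ^ m.natAbs) := by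
        rw [ENNReal.tsum_mul_left,
          ← (Equiv.subRight n).tsum_eq fun m : ℤ => ENNReal.ofReal (q ^ m.natAbs)]
        rfl
    _ = _ := by
        rw [← ENNReal.ofReal_tsum_of_nonneg (fun m => by positivity) hsum, ← hMAB,
          ← ENNReal.ofReal_mul (by positivity), ← ENNReal.ofReal_mul (by positivity)]
        congr 1
        ring

end KSE

/-- Besov interpolation inequality: for `1 ≤ s < r < ∞`, `β > 0`,
`α = s/r`, `γ = β(r/s - 1)`, there is `C > 0` such that every mean-zero periodic `g`
satisfies `‖g‖_{L^r(𝕋^d)} ≤ C ‖g‖_{Ḃ^{-β}_{∞,∞}}^{1-α} ‖g‖_{Ḃ^{γ}_{s,s}}^{α}`. -/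
theorem besov_interpolation_inequality
    (d : ℕ) (hd : 0 < d) (s r β : ℝ) (hs : 1 ≤ s) (hsr : s < r) (hβ : 0 < β)
    (φ : (Fin d → ℝ) → ℝ) (hφ : IsLP d φ) :
    ∃ C : ℝ, 0 < C ∧ ∀ g : (Fin d → ℝ) → ℝ, SpacePeriodic g →
      MeasureTheory.IntegrableOn g (Q d) → (∫ x in Q d, g x) = 0 →
      (∫⁻ x in Q d, eR (g x) ^ r) ^ (1 / r) ≤
        ENNReal.ofReal C * besovInfInf φ (-β) g ^ (1 - s / r) *
          besovPP φ (β * (r / s - 1)) s g ^ (s / r) := by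
  have hs0 : 0 < s := zero_lt_one.trans_le hs
  have hr0 : 0 < r := hs0.trans hsr
  have hγ : 0 < β * (r / s - 1) := mul_pos hβ (sub_pos.2 ((one_lt_div hs0).2 hsr))
  set γ := β * (r / s - 1) with hγdef
  have hβγ : β + γ = β * (r / s) := by rw [hγdef]; ring
  have hα1 : γ / (β + γ) = 1 - s / r := by rw [hβγ, hγdef]; field_simp
  have hα2 : β / (β + γ) = s / r := by rw [hβγ]; field_simp
  have hα0 : 0 < s / r := div_pos hs0 hr0
  have hα0' : 0 < 1 - s / r := sub_pos.2 ((div_lt_one hr0).2 hsr)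
  obtain ⟨C, hC, hinterp⟩ := exists_tsum_le_interpolation hβ hγ
  rw [hα1, hα2] at hinterp
  refine ⟨C, hC, fun g _ hg hmean => ?_⟩
  set A := besovInfInf φ (-β) g
  set B := besovPP φ γ s g with hB
  set F : (Fin d → ℝ) → ℝ≥0∞ := fun x =>
    ∑' j : ℤ, (ENNReal.ofReal ((2 : ℝ) ^ (γ * j)) * eC (lpBlock φ j g x)) ^ s with hF
  set G : (Fin d → ℝ) → ℝ≥0∞ := fun x => ∑' j : ℤ, eC (lpBlock φ j g x) with hG
  have hw : ∀ x : ℝ, ENNReal.ofReal ((2 : ℝ) ^ x) ≠ 0 := fun x => by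
    simpa using Real.rpow_pos_of_pos zero_lt_two x
  have hCne : ENNReal.ofReal C ≠ 0 := by simpa using hC
  have hboundA : ∀ x ∈ Q d, ∀ j : ℤ,
      ENNReal.ofReal ((2 : ℝ) ^ (-β * j)) * eC (lpBlock φ j g x) ≤ A := fun x hx j =>
    (mul_le_mul_right (le_iSup₂ (f := fun x _ => eC (lpBlock φ j g x)) x hx) _).trans
      (le_iSup (fun j : ℤ => ENNReal.ofReal (Real.rpow 2 (-β * j)) *
        ⨆ x ∈ Q d, eC (lpBlock φ j g x)) j)
  have hboundF : ∀ x, ∀ j : ℤ,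
      ENNReal.ofReal ((2 : ℝ) ^ (γ * j)) * eC (lpBlock φ j g x) ≤ F x ^ (1 / s) := fun x j => by
    rw [one_div, ENNReal.le_rpow_inv_iff hs0]
    exact ENNReal.le_tsum (f := fun j : ℤ =>
      (ENNReal.ofReal ((2 : ℝ) ^ (γ * j)) * eC (lpBlock φ j g x)) ^ s) j
  have hmeasT : ∀ j : ℤ, Measurable fun x =>
      (ENNReal.ofReal ((2 : ℝ) ^ (γ * j)) * eC (lpBlock φ j g x)) ^ s := fun j =>
    ((measurable_eC_lpBlock hφ j g).const_mul _).pow_const s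
  have hmeasF : Measurable F := Measurable.tsum hmeasT
  have hFB : ∫⁻ x in Q d, F x = B ^ s := by
    rw [hB, besovPP, ← ENNReal.rpow_mul, one_div_mul_cancel hs0.ne', ENNReal.rpow_one, hF,
      lintegral_tsum fun j => (hmeasT j).aemeasurable]
    refine tsum_congr fun j => ?_
    simp only [ENNReal.mul_rpow_of_nonneg _ _ hs0.le]
    rw [lintegral_const_mul _ ((measurable_eC_lpBlock hφ j g).pow_const s), ← ENNReal.rpow_mul,
      one_div_mul_cancel hs0.ne', ENNReal.rpow_one]
    rfl
  have main : ∀ D : ℝ≥0∞, (∀ᵐ x ∂volume.restrict (Q d), G x ^ r ≤ D * F x) →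
      D * B ^ s ≠ ⊤ → ∫⁻ x in Q d, eR (g x) ^ r ≤ D * B ^ s := by
    intro D hGD hfin
    have hGr : ∫⁻ x in Q d, G x ^ r ≤ D * B ^ s := by
      rw [← hFB, ← lintegral_const_mul _ hmeasF]
      exact lintegral_mono_ae hGD
    have hGint : ∫⁻ x in Q d, G x ≠ ⊤ := by
      have hle : ∫⁻ x in Q d, G x ≤ ∫⁻ x in Q d, (1 + G x ^ r) := lintegral_mono fun x => by
        rcases le_total (G x) 1 with h | h
        · exact h.trans le_self_add
        · exact (ENNReal.le_rpow_self_of_one_le h (hs.trans hsr.le)).trans le_add_self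
      refine (hle.trans_lt ?_).ne
      rw [lintegral_add_left measurable_const]
      refine ENNReal.add_lt_top.2 ⟨?_, hGr.trans_lt hfin.lt_top⟩
      simpa using (isCompact_Q d).measure_lt_top
    refine (lintegral_mono_ae ?_).trans hGr
    filter_upwards [ae_eR_le_tsum_lpBlock hφ hg hmean hGint] with x hx
    exact ENNReal.rpow_le_rpow hx hr0.le
  have hzero : (∀ᵐ x ∂volume.restrict (Q d), ∀ j : ℤ, eC (lpBlock φ j g x) = 0) →
      (∫⁻ x in Q d, eR (g x) ^ r) ^ (1 / r) = 0 := by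
    intro h
    have h0 : ∫⁻ x in Q d, eR (g x) ^ r ≤ 0 * B ^ s := by
      refine main 0 ?_ (by simp)
      filter_upwards [h] with x hx
      simp [hG, hx, hr0]
    rw [zero_mul, nonpos_iff_eq_zero] at h0
    rw [h0, ENNReal.zero_rpow_of_pos (one_div_pos.2 hr0)]
  by_cases hAtop : A = ⊤
  · by_cases hB0 : B = 0
    · rw [hzero]
      · exact zero_le
      · rw [hB0, ENNReal.zero_rpow_of_pos hs0, lintegral_eq_zero_iff hmeasF] at hFB
        filter_upwards [hFB] with x hx j
        have h := hboundF x j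
        rw [hx, Pi.zero_apply, ENNReal.zero_rpow_of_pos (one_div_pos.2 hs0),
          nonpos_iff_eq_zero] at h
        exact (mul_eq_zero.1 h).resolve_left (hw _)
    · rw [hAtop, ENNReal.top_rpow_of_pos hα0', ENNReal.mul_top hCne, ENNReal.top_mul]
      · exact le_top
      · simp [ENNReal.rpow_eq_zero_iff, hB0, hα0.not_gt]
  by_cases hBtop : B = ⊤
  · by_cases hA0 : A = 0
    · rw [hzero]
      · exact zero_le
      · refine ae_restrict_of_forall_mem (measurableSet_Q d) fun x hx j => ?_
        have h := hboundA x hx j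
        rw [hA0, nonpos_iff_eq_zero] at h
        exact (mul_eq_zero.1 h).resolve_left (hw _)
    · rw [hBtop, ENNReal.top_rpow_of_pos hα0, ENNReal.mul_top]
      · exact le_top
      · refine mul_ne_zero hCne ?_
        simp [ENNReal.rpow_eq_zero_iff, hA0, hAtop]
  have hBs : B ^ s ≠ ⊤ := ENNReal.rpow_ne_top_of_nonneg hs0.le hBtop
  have hD : (ENNReal.ofReal C * A ^ (1 - s / r)) ^ r ≠ ⊤ :=
    ENNReal.rpow_ne_top_of_nonneg hr0.le (ENNReal.mul_ne_top ENNReal.ofReal_ne_top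
      (ENNReal.rpow_ne_top_of_nonneg hα0'.le hAtop))
  have hGD : ∀ᵐ x ∂volume.restrict (Q d),
      G x ^ r ≤ (ENNReal.ofReal C * A ^ (1 - s / r)) ^ r * F x := by
    filter_upwards [ae_lt_top hmeasF (by rwa [hFB]), ae_restrict_mem (measurableSet_Q d)]
      with x hFx hx
    have h := hinterp (fun j => eC (lpBlock φ j g x)) A (F x ^ (1 / s)) hAtop
      (ENNReal.rpow_ne_top_of_nonneg (one_div_pos.2 hs0).le hFx.ne) (hboundA x hx) (hboundF x)
    have h' := ENNReal.rpow_le_rpow h hr0.le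
    rwa [← mul_assoc, ENNReal.mul_rpow_of_nonneg _ _ hr0.le, ← ENNReal.rpow_mul,
      ← ENNReal.rpow_mul, show 1 / s * (s / r * r) = 1 by field_simp, ENNReal.rpow_one] at h'
  calc (∫⁻ x in Q d, eR (g x) ^ r) ^ (1 / r)
      ≤ ((ENNReal.ofReal C * A ^ (1 - s / r)) ^ r * B ^ s) ^ (1 / r) :=
        ENNReal.rpow_le_rpow (main _ hGD (ENNReal.mul_ne_top hD hBs)) (one_div_pos.2 hr0).le
    _ = ENNReal.ofReal C * A ^ (1 - s / r) * B ^ (s / r) := by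
        rw [ENNReal.mul_rpow_of_nonneg _ _ (one_div_pos.2 hr0).le, ← ENNReal.rpow_mul,
          ← ENNReal.rpow_mul, mul_one_div_cancel hr0.ne', ENNReal.rpow_one, mul_one_div]
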